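/- arXiv:1404.6471 — 2 statements merged into one kernel-verified Lean document; each statement's English description precedes it below -/
import Mathlib

section
/- Let Z be a random variable with values in a finite alphabet 𝒵, let Z^n be n i.i.d. copies of Z, and let C be a random binning codebook at rates (R_Z, R_S), independent of Z^n. If R_S ≥ 0, R_Z ≥ 0 and R_S + R_Z ≤ H(Z) − 2δ for some δ > 0, then limsup_{n→∞} (1/n)·H(Z^n | f(Z^n), φ(Z^n), C) ≤ H(Z) − R_S − R_Z + δ. -/
open Filter

/-- A probability distribution on a finite sample space `Ω`, given by nonnegative weights
summing to one. -/
structure FinProb (Ω : Type*) [Fintype Ω] where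
  w : Ω → ℝ
  nonneg : ∀ ω, 0 ≤ w ω
  sum_one : ∑ ω, w ω = 1

open scoped Classical in
/-- The distribution (probability mass function) of a random variable `X : Ω → S`. -/
noncomputable def FinProb.dist {Ω : Type*} [Fintype Ω] (P : FinProb Ω)
    {S : Type*} (X : Ω → S) (s : S) : ℝ :=
  ∑ ω ∈ Finset.univ.filter (fun ω => X ω = s), P.w ω

/-- Shannon entropy (base-2 logarithm) of a random variable `X : Ω → S`. -/
noncomputable def FinProb.H {Ω : Type*} [Fintype Ω] (P : FinProb Ω)
    {S : Type*} [Fintype S] (X : Ω → S) : ℝ :=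
  - ∑ s, P.dist X s * Real.logb 2 (P.dist X s)

/-- Conditional Shannon entropy H(X|Y) (base-2 logarithm). -/
noncomputable def FinProb.condH {Ω : Type*} [Fintype Ω] (P : FinProb Ω)
    {S T : Type*} [Fintype S] [Fintype T]
    (X : Ω → S) (Y : Ω → T) : ℝ :=
  P.H (fun ω => (X ω, Y ω)) - P.H Y

/-- Shannon entropy (base-2 logarithm) of a probability mass function `p` on a finite
alphabet. -/
noncomputable def pmfEntropy {S : Type*} [Fintype S] (p : S → ℝ) : ℝ :=
  - ∑ s, p s * Real.logb 2 (p s)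

/-- `⌈2^(n·R)⌉`, the number of labels used by a random binning codebook of rate `R` at
blocklength `n`. -/
noncomputable def nLabels (R : ℝ) (n : ℕ) : ℕ := ⌈(2 : ℝ) ^ ((n : ℝ) * R)⌉₊

instance (R : ℝ) (n : ℕ) : NeZero (nLabels R n) :=
  ⟨Nat.pos_iff_ne_zero.mp (Nat.ceil_pos.mpr (by positivity))⟩

instance (R : ℝ) (n : ℕ) : Nonempty (Fin (nLabels R n)) :=
  ⟨⟨0, Nat.pos_of_ne_zero (NeZero.ne _)⟩⟩

/-- The sum over all sequences of the product of i.i.d. letter probabilities is one. -/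
theorem iid_sum_one {𝒵 : Type*} [Fintype 𝒵] {p : 𝒵 → ℝ}
    (hp1 : ∑ z, p z = 1) (n : ℕ) :
    ∑ z : Fin n → 𝒵, ∏ i, p (z i) = 1 := by
  classical
  have h := Finset.prod_univ_sum (fun _ : Fin n => (Finset.univ : Finset 𝒵))
    (fun _ z => p z)
  rw [Fintype.piFinset_univ] at h
  rw [← h]
  simp [hp1]

/-- The joint distribution of an i.i.d.-style source with pmf `q` on the finite set `S`,
together with an independent uniformly distributed random codebook `C`: every label
assignment (element of the finite function space `C`) is equally likely, which is the same
as saying that all the labels are mutually independent and uniformly distributed, and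
independent of the source. -/
noncomputable def srcCbProb {S C : Type*} [Fintype S] [Fintype C] [Nonempty C]
    (q : S → ℝ) (h0 : ∀ s, 0 ≤ q s) (h1 : ∑ s, q s = 1) : FinProb (S × C) where
  w := fun sc => q sc.1 * ((Fintype.card C : ℝ))⁻¹
  nonneg := fun sc => mul_nonneg (h0 _) (by positivity)
  sum_one := by
    have hC : (Fintype.card C : ℝ) ≠ 0 := by
      exact_mod_cast Fintype.card_ne_zero
    have hs : ∀ s : S, ∑ _c : C, q s * ((Fintype.card C : ℝ))⁻¹ = q s := by
      intro s
      rw [Finset.sum_const, Finset.card_univ, nsmul_eq_mul]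
      field_simp
    rw [Fintype.sum_prod_type]
    simp_rw [hs]
    exact h1

open scoped Classical in
theorem FinProb.dist_eq_ite {Ω : Type*} [Fintype Ω] (P : FinProb Ω)
    {S : Type*} (X : Ω → S) (s : S) :
    P.dist X s = ∑ ω, if X ω = s then P.w ω else 0 := by
  unfold FinProb.dist
  rw [Finset.sum_filter]

theorem FinProb.H_eq {Ω : Type*} [Fintype Ω] (P : FinProb Ω)
    {S : Type*} [Fintype S] (X : Ω → S) :
    P.H X = - ∑ ω, P.w ω * Real.logb 2 (P.dist X (X ω)) := by
  classical
  unfold FinProb.H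
  congr 1
  have h1 : ∀ s, P.dist X s * Real.logb 2 (P.dist X s)
      = ∑ ω, if X ω = s then P.w ω * Real.logb 2 (P.dist X (X ω)) else 0 := by
    intro s
    nth_rewrite 1 [P.dist_eq_ite X s]
    rw [Finset.sum_mul]
    refine Finset.sum_congr rfl fun ω _ => ?_
    split_ifs with h
    · rw [h]
    · simp
  simp_rw [h1]
  rw [Finset.sum_comm]
  refine Finset.sum_congr rfl fun ω _ => ?_
  simp

theorem FinProb.w_le_dist {Ω : Type*} [Fintype Ω] (P : FinProb Ω)
    {S : Type*} (X : Ω → S) (ω : Ω) : P.w ω ≤ P.dist X (X ω) := by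
  classical
  rw [P.dist_eq_ite]
  have := Finset.single_le_sum (f := fun ω' => if X ω' = X ω then P.w ω' else 0)
    (fun i _ => by
      show 0 ≤ if X i = X ω then P.w i else 0
      split_ifs
      · exact P.nonneg i
      · exact le_rfl) (Finset.mem_univ ω)
  simpa using this

theorem FinProb.dist_inj {Ω : Type*} [Fintype Ω] (P : FinProb Ω)
    {S : Type*} (X : Ω → S) (hX : Function.Injective X) (ω : Ω) :
    P.dist X (X ω) = P.w ω := by
  classical
  rw [P.dist_eq_ite]
  simp [hX.eq_iff]

theorem FinProb.condH_eq {Ω : Type*} [Fintype Ω] (P : FinProb Ω)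
    {S T : Type*} [Fintype S] [Fintype T] (X : Ω → S) (Y : Ω → T)
    (hX : Function.Injective (fun ω => (X ω, Y ω))) :
    P.condH X Y = ∑ ω, P.w ω * (Real.logb 2 (P.dist Y (Y ω)) - Real.logb 2 (P.w ω)) := by
  unfold FinProb.condH
  rw [P.H_eq, P.H_eq]
  simp_rw [mul_sub]
  rw [Finset.sum_sub_distrib]
  have : ∀ ω, P.dist (fun ω => (X ω, Y ω)) (X ω, Y ω) = P.w ω := fun ω => P.dist_inj _ hX ω
  simp_rw [this]
  ring

theorem FinProb.condH_nonneg {Ω : Type*} [Fintype Ω] (P : FinProb Ω)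
    {S T : Type*} [Fintype S] [Fintype T] (X : Ω → S) (Y : Ω → T)
    (hX : Function.Injective (fun ω => (X ω, Y ω))) : 0 ≤ P.condH X Y := by
  rw [P.condH_eq X Y hX]
  refine Finset.sum_nonneg fun ω _ => ?_
  rcases (P.nonneg ω).eq_or_lt with h | h
  · simp [← h]
  · refine mul_nonneg h.le (sub_nonneg.2 ?_)
    exact Real.logb_le_logb_of_le (by norm_num) h (P.w_le_dist Y ω)

open scoped Classical in
theorem collision_sum {S T : Type*} [Fintype S] [Fintype T] [Nonempty T] (s s' : S)
    (h : s ≠ s') :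
    ((Fintype.card (S → T) : ℝ))⁻¹ * ∑ c : S → T, (if c s' = c s then (1 : ℝ) else 0)
      = (Fintype.card T : ℝ)⁻¹ := by
  have hT : (Fintype.card T : ℝ) ≠ 0 := by exact_mod_cast Fintype.card_ne_zero
  have e := Equiv.funSplitAt s' T
  have h1 : ∑ c : S → T, (if c s' = c s then (1 : ℝ) else 0)
      = ∑ x : T × ({j // j ≠ s'} → T), (if x.1 = x.2 ⟨s, h⟩ then (1 : ℝ) else 0) := by
    refine Fintype.sum_equiv (Equiv.funSplitAt s' T) _ _ fun c => ?_
    simp [Equiv.funSplitAt, Equiv.piSplitAt]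
  have h2 : Fintype.card (S → T) = Fintype.card T * Fintype.card ({j // j ≠ s'} → T) := by
    rw [Fintype.card_congr (Equiv.funSplitAt s' T), Fintype.card_prod]
  have h3 : (Fintype.card ({j // j ≠ s'} → T) : ℝ) ≠ 0 := by
    exact_mod_cast Fintype.card_ne_zero
  rw [h1, h2, Fintype.sum_prod_type_right]
  simp only [Finset.sum_ite_eq', Finset.mem_univ, if_true, Finset.sum_const, Finset.card_univ,
    nsmul_eq_mul, mul_one]
  push_cast only [Nat.cast_mul]
  field_simp

theorem avg_logb_le {C : Type*} [Fintype C] (k : ℝ) (hk : 0 ≤ k)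
    (hk1 : ∑ _c : C, k = 1) (y : C → ℝ) (hy : ∀ c, 0 < y c) (a : ℝ) (ha : 0 < a)
    (hya : k * ∑ c, y c ≤ a) : ∑ c, k * Real.logb 2 (y c) ≤ Real.logb 2 a := by
  have hl : 0 < Real.log 2 := Real.log_pos (by norm_num)
  have h1 : ∀ c, k * Real.logb 2 (y c) ≤
      k * (Real.logb 2 a - 1 / Real.log 2) + (k * y c) * (1 / (a * Real.log 2)) := by
    intro c
    have h2 := Real.log_le_sub_one_of_pos (div_pos (hy c) ha)
    rw [Real.log_div (hy c).ne' ha.ne'] at h2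
    have h3 : Real.logb 2 (y c) ≤ Real.logb 2 a - 1 / Real.log 2
        + y c * (1 / (a * Real.log 2)) := by
      unfold Real.logb
      have : Real.log a / Real.log 2 - 1 / Real.log 2 + y c * (1 / (a * Real.log 2))
        = (Real.log a - 1 + y c / a) / Real.log 2 := by field_simp
      rw [this]
      exact div_le_div_of_nonneg_right (by linarith) hl.le
    calc _ ≤ k * _ := mul_le_mul_of_nonneg_left h3 hk
      _ = _ := by ring
  refine (Finset.sum_le_sum fun c _ => h1 c).trans ?_
  rw [Finset.sum_add_distrib, ← Finset.sum_mul, ← Finset.sum_mul, hk1, ← Finset.mul_sum]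
  have h4 : (k * ∑ c, y c) * (1 / (a * Real.log 2)) ≤ a * (1 / (a * Real.log 2)) :=
    mul_le_mul_of_nonneg_right hya (by positivity)
  have h5 : a * (1 / (a * Real.log 2)) = 1 / Real.log 2 := by field_simp
  linarith

theorem oneshot {S T : Type*} [Fintype S] [Fintype T] [Nonempty T]
    (q : S → ℝ) (h0 : ∀ s, 0 ≤ q s) (h1 : ∑ s, q s = 1) [Fintype (S → T)] [Nonempty (S → T)] :
    (srcCbProb (C := S → T) q h0 h1).condH (fun ω => ω.1) (fun ω => (ω.2 ω.1, ω.2))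
      ≤ ∑ s, q s * (Real.logb 2 (q s + (Fintype.card T : ℝ)⁻¹) - Real.logb 2 (q s)) := by
  classical
  have hK : (0 : ℝ) < Fintype.card (S → T) := by exact_mod_cast Fintype.card_pos
  have hM : (0 : ℝ) < Fintype.card T := by exact_mod_cast Fintype.card_pos
  rw [FinProb.condH_eq _ _ _ (by
    rintro ⟨a, b⟩ ⟨c, d⟩ h
    simp only [Prod.mk.injEq] at h
    ext1
    · exact h.1
    · exact h.2.2)]
  rw [Fintype.sum_prod_type]
  refine Finset.sum_le_sum fun s _ => ?_
  set K : ℝ := (Fintype.card (S → T) : ℝ) with hKdef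
  have hD : ∀ c : S → T, (srcCbProb (C := S → T) q h0 h1).dist
      (fun ω => (ω.2 ω.1, ω.2)) (c s, c) = K⁻¹ * ∑ s', if c s' = c s then q s' else 0 := by
    intro c
    rw [FinProb.dist_eq_ite, Fintype.sum_prod_type, Finset.mul_sum]
    refine Finset.sum_congr rfl fun s' _ => ?_
    rw [Finset.sum_eq_single c]
    · simp only [srcCbProb, Prod.mk.injEq, and_true]
      split_ifs
      · rw [mul_comm]
      · simp
    · intro b _ hb
      simp [hb]
    · simp
  rcases (h0 s).eq_or_lt with hs | hs
  · simp [srcCbProb, ← hs]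
  have hQ : ∀ c : S → T, 0 < ∑ s', if c s' = c s then q s' else 0 := by
    intro c
    refine Finset.sum_pos' (fun i _ => ?_) ⟨s, Finset.mem_univ _, by simpa using hs⟩
    split_ifs
    · exact h0 i
    · exact le_rfl
  have hterm : ∀ c : S → T, (srcCbProb (C := S → T) q h0 h1).w (s, c) *
      (Real.logb 2 ((srcCbProb (C := S → T) q h0 h1).dist
      (fun ω => (ω.2 ω.1, ω.2)) (c s, c)) - Real.logb 2 ((srcCbProb (C := S → T) q h0 h1).w (s, c)))
      = q s * (K⁻¹ * Real.logb 2 (∑ s', if c s' = c s then q s' else 0)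
        - K⁻¹ * Real.logb 2 (q s)) := by
    intro c
    rw [hD]
    simp only [srcCbProb]
    rw [← hKdef, Real.logb_mul (inv_pos.2 hK).ne' (hQ c).ne',
      Real.logb_mul hs.ne' (inv_pos.2 hK).ne']
    ring
  have hsum1 : ∑ _c : S → T, K⁻¹ = 1 := by
    rw [Finset.sum_const, Finset.card_univ, nsmul_eq_mul, ← hKdef]
    field_simp
  simp only [hterm]
  rw [← Finset.mul_sum, Finset.sum_sub_distrib, ← Finset.sum_mul, hsum1, one_mul]
  refine mul_le_mul_of_nonneg_left (sub_le_sub_right ?_ _) hs.le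
  refine avg_logb_le K⁻¹ (inv_pos.2 hK).le hsum1 _ hQ _ (by positivity) ?_
  rw [Finset.sum_comm, Finset.mul_sum]
  have hs' : ∀ s' : S, K⁻¹ * ∑ c : S → T, (if c s' = c s then q s' else 0)
      ≤ (if s' = s then q s else 0) + q s' * (Fintype.card T : ℝ)⁻¹ := by
    intro s'
    have e : ∑ c : S → T, (if c s' = c s then q s' else 0)
        = q s' * ∑ c : S → T, (if c s' = c s then (1 : ℝ) else 0) := by
      rw [Finset.mul_sum]
      exact Finset.sum_congr rfl fun c _ => by simp
    by_cases h : s' = s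
    · subst h
      have : 0 ≤ q s' * (Fintype.card T : ℝ)⁻¹ := by positivity
      simp only [if_true, Finset.sum_const, Finset.card_univ, nsmul_eq_mul, ← hKdef]
      rw [← mul_assoc, inv_mul_cancel₀ hK.ne']
      linarith
    · have hc := collision_sum (T := T) s s' (Ne.symm h)
      rw [e, if_neg h, zero_add, mul_left_comm]
      refine le_of_eq ?_
      congr 1
      rw [← hc, hKdef]
      congr!
  refine (Finset.sum_le_sum fun s' _ => hs' s').trans ?_
  rw [Finset.sum_add_distrib, ← Finset.sum_mul, h1]
  simp

theorem iid_var {A : Type*} [Fintype A] (p g : A → ℝ) (hp1 : ∑ z, p z = 1)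
    (hg : ∑ z, p z * g z = 0) (n : ℕ) :
    (∑ z : Fin n → A, (∏ i, p (z i)) * (∑ i, g (z i)) = 0) ∧
    (∑ z : Fin n → A, (∏ i, p (z i)) * (∑ i, g (z i)) ^ 2 = n * ∑ z, p z * g z ^ 2) := by
  induction n with
  | zero => simp
  | succ n ih =>
    obtain ⟨ih1, ih2⟩ := ih
    have hs := iid_sum_one hp1 n
    have key : ∀ F : (Fin (n+1) → A) → ℝ, ∑ z, F z = ∑ a : A, ∑ z : Fin n → A, F (Fin.cons a z) := by
      intro F
      rw [← Fintype.sum_prod_type']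
      exact (Fintype.sum_equiv (Fin.consEquiv fun _ => A) _ _ fun x => rfl).symm
    constructor
    · rw [key]
      simp only [Fin.prod_univ_succ, Fin.sum_univ_succ, Fin.cons_zero, Fin.cons_succ]
      have : ∀ a : A, ∑ z : Fin n → A, p a * (∏ i, p (z i)) * (g a + ∑ i, g (z i))
          = p a * g a := by
        intro a
        have : ∀ z : Fin n → A, p a * (∏ i, p (z i)) * (g a + ∑ i, g (z i))
          = p a * g a * (∏ i, p (z i)) + p a * ((∏ i, p (z i)) * ∑ i, g (z i)) :=
          fun z => by ring
        simp_rw [this]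
        rw [Finset.sum_add_distrib, ← Finset.mul_sum, ← Finset.mul_sum, hs, ih1]
        ring
      simp_rw [this, hg]
    · rw [key]
      simp only [Fin.prod_univ_succ, Fin.sum_univ_succ, Fin.cons_zero, Fin.cons_succ]
      have : ∀ a : A, ∑ z : Fin n → A, p a * (∏ i, p (z i)) * (g a + ∑ i, g (z i)) ^ 2
          = p a * g a ^ 2 + p a * (n * ∑ z, p z * g z ^ 2) := by
        intro a
        have : ∀ z : Fin n → A, p a * (∏ i, p (z i)) * (g a + ∑ i, g (z i)) ^ 2
          = p a * g a ^ 2 * (∏ i, p (z i)) + 2 * p a * g a * ((∏ i, p (z i)) * ∑ i, g (z i))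
            + p a * ((∏ i, p (z i)) * (∑ i, g (z i)) ^ 2) :=
          fun z => by ring
        simp_rw [this]
        rw [Finset.sum_add_distrib, Finset.sum_add_distrib, ← Finset.mul_sum, ← Finset.mul_sum,
          ← Finset.mul_sum, hs, ih1, ih2]
        ring
      simp_rw [this]
      rw [Finset.sum_add_distrib, ← Finset.sum_mul, hp1]
      push_cast
      ring

/-- Pointwise bound. -/
theorem point_bound (q M x a d : ℝ) (hq : 0 < q) (hM : 0 < M) (ha : 0 < a) (hd : 0 ≤ d)
    (hx : -Real.logb 2 q - Real.logb 2 M ≤ d + x) :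
    Real.logb 2 (q + M⁻¹) - Real.logb 2 q ≤ 1 + d + (x ^ 2 / (2 * a) + a / 2) := by
  have hxx : |x| ≤ x ^ 2 / (2 * a) + a / 2 := by
    have : x ^ 2 / (2 * a) + a / 2 - |x| = (|x| - a) ^ 2 / (2 * a) := by
      rw [← sq_abs x]; field_simp; ring
    have h2 : 0 ≤ (|x| - a) ^ 2 / (2 * a) := by positivity
    linarith
  have h2 : Real.logb 2 2 = 1 := Real.logb_self_eq_one (by norm_num)
  have hMi : 0 < M⁻¹ := inv_pos.2 hM
  have habs := le_abs_self x
  have habs0 := abs_nonneg x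
  rcases le_total q M⁻¹ with h | h
  · have h3 : Real.logb 2 (q + M⁻¹) ≤ Real.logb 2 (2 * M⁻¹) :=
      Real.logb_le_logb_of_le (by norm_num) (by positivity) (by linarith)
    rw [Real.logb_mul (by norm_num) hMi.ne', h2, Real.logb_inv] at h3
    linarith
  · have h3 : Real.logb 2 (q + M⁻¹) ≤ Real.logb 2 (2 * q) :=
      Real.logb_le_logb_of_le (by norm_num) (by positivity) (by linarith)
    rw [Real.logb_mul (by norm_num) hq.ne', h2] at h3
    linarith

theorem logb_nLabels (R : ℝ) (n : ℕ) : n * R ≤ Real.logb 2 (nLabels R n : ℝ) := by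
  have h : (2 : ℝ) ^ ((n : ℝ) * R) ≤ (nLabels R n : ℝ) := Nat.le_ceil _
  have h1 := Real.logb_le_logb_of_le (b := 2) (by norm_num) (by positivity) h
  rwa [Real.logb_rpow (by norm_num) (by norm_num)] at h1

/-- Let `Z` be a random variable with values in a finite alphabet `𝒵` with pmf
`p`, let `Z^n` be `n` i.i.d. copies of `Z`, and let `C` be a random binning codebook at rates
`(R_Z, R_S)` (i.e. `C` assigns to each sequence `z ∈ 𝒵^n` a pair of labels
`(f(z), φ(z)) ∈ {1,…,⌈2^{nR_Z}⌉} × {1,…,⌈2^{nR_S}⌉}`, all labels mutually independent and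
uniform), independent of `Z^n`. If `R_S ≥ 0`, `R_Z ≥ 0` and `R_S + R_Z ≤ H(Z) − 2δ` for some
`δ > 0`, then `limsup_{n→∞} (1/n)·H(Z^n | f(Z^n), φ(Z^n), C) ≤ H(Z) − R_S − R_Z + δ`. -/
theorem statement0 {𝒵 : Type*} [Fintype 𝒵] [DecidableEq 𝒵] (p : 𝒵 → ℝ)
    (hp0 : ∀ z, 0 ≤ p z) (hp1 : ∑ z, p z = 1)
    (R_Z R_S δ : ℝ) (hRS : 0 ≤ R_S) (hRZ : 0 ≤ R_Z) (hδ : 0 < δ)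
    (hrate : R_S + R_Z ≤ pmfEntropy p - 2 * δ) :
    Filter.limsup (fun n : ℕ =>
        (1 / (n : ℝ)) *
          (srcCbProb (fun z : Fin n → 𝒵 => ∏ i, p (z i))
              (fun z => Finset.prod_nonneg fun i _ => hp0 (z i))
              (iid_sum_one hp1 n)).condH
            (fun ω => ω.1)
            (fun ω : (Fin n → 𝒵) ×
                ((Fin n → 𝒵) → Fin (nLabels R_Z n) × Fin (nLabels R_S n)) =>
              (ω.2 ω.1, ω.2)))
      Filter.atTop
    ≤ pmfEntropy p - R_S - R_Z + δ := by
  have hinj : ∀ n : ℕ, Function.Injective (fun ω : (Fin n → 𝒵) ×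
      ((Fin n → 𝒵) → Fin (nLabels R_Z n) × Fin (nLabels R_S n)) => (ω.1, (ω.2 ω.1, ω.2))) := by
    rintro n ⟨a, b⟩ ⟨c, d⟩ h
    simp only [Prod.mk.injEq] at h
    ext1
    · exact h.1
    · exact h.2.2
  set h := pmfEntropy p with hh
  set V := ∑ z, p z * (-Real.logb 2 (p z) - h) ^ 2 with hV
  have hg : ∑ z, p z * (-Real.logb 2 (p z) - h) = 0 := by
    simp_rw [mul_sub]
    rw [Finset.sum_sub_distrib, ← Finset.sum_mul, hp1]
    simp [hh, pmfEntropy]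
  have hVn : 0 ≤ V := Finset.sum_nonneg fun z _ => mul_nonneg (hp0 z) (sq_nonneg _)
  have hev : ∀ᶠ n : ℕ in atTop, 0 < n ∧ (1 + V / (2 * δ)) ≤ n * (δ / 2) := by
    refine (eventually_gt_atTop 0).and ?_
    have : Tendsto (fun n : ℕ => (n : ℝ) * (δ / 2)) atTop atTop :=
      tendsto_natCast_atTop_atTop.atTop_mul_const (by positivity)
    exact this.eventually_ge_atTop _
  refine Filter.limsup_le_of_le ?_ ?_
  · refine Filter.IsBoundedUnder.isCoboundedUnder_le ?_
    refine ⟨0, ?_⟩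
    rw [Filter.eventually_map]
    refine Filter.Eventually.of_forall fun n => ?_
    exact mul_nonneg (by positivity) (FinProb.condH_nonneg _ _ _ (hinj n))
  · filter_upwards [hev] with n hn
    obtain ⟨hn0, hn1⟩ := hn
    have hnR : (0 : ℝ) < n := by exact_mod_cast hn0
    have hv := iid_var p (fun z => -Real.logb 2 (p z) - h) hp1 hg n
    have hs := iid_sum_one hp1 n
    have hM1 : (0 : ℝ) < nLabels R_Z n := by exact_mod_cast Nat.pos_of_ne_zero (NeZero.ne _)
    have hM2 : (0 : ℝ) < nLabels R_S n := by exact_mod_cast Nat.pos_of_ne_zero (NeZero.ne _)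
    rw [one_div, inv_mul_le_iff₀ hnR]
    refine (oneshot _ _ _).trans ?_
    have hcard : (Fintype.card (Fin (nLabels R_Z n) × Fin (nLabels R_S n)) : ℝ)
        = (nLabels R_Z n : ℝ) * nLabels R_S n := by simp
    rw [hcard]
    have hpt : ∀ z : Fin n → 𝒵, (∏ i, p (z i)) * (Real.logb 2 ((∏ i, p (z i)) +
        ((nLabels R_Z n : ℝ) * nLabels R_S n)⁻¹) - Real.logb 2 (∏ i, p (z i)))
        ≤ (∏ i, p (z i)) * (1 + n * (h - R_S - R_Z) + n * δ / 2) +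
          ((∏ i, p (z i)) * (∑ i, (-Real.logb 2 (p (z i)) - h)) ^ 2) * (1 / (2 * (n * δ))) := by
      intro z
      rcases (Finset.prod_nonneg fun i _ => hp0 (z i) : 0 ≤ ∏ i, p (z i)).eq_or_lt with hq | hq
      · simp [← hq]
      have hne : ∀ i, p (z i) ≠ 0 := fun i => Finset.prod_ne_zero_iff.1 hq.ne' i (Finset.mem_univ _)
      have hlog : Real.logb 2 (∏ i, p (z i)) = ∑ i, Real.logb 2 (p (z i)) :=
        Real.logb_prod _ _ fun i _ => hne i
      have hb := point_bound (∏ i, p (z i)) ((nLabels R_Z n : ℝ) * nLabels R_S n)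
        (∑ i, (-Real.logb 2 (p (z i)) - h)) (n * δ) (n * (h - R_S - R_Z)) hq (by positivity)
        (by positivity) (mul_nonneg hnR.le (by linarith)) (by
          rw [Real.logb_mul hM1.ne' hM2.ne', hlog, Finset.sum_sub_distrib, Finset.sum_neg_distrib]
          simp only [Finset.sum_const, Finset.card_univ, Fintype.card_fin, nsmul_eq_mul]
          have h1 := logb_nLabels R_Z n
          have h2 := logb_nLabels R_S n
          linarith)
      calc _ ≤ (∏ i, p (z i)) * _ := mul_le_mul_of_nonneg_left hb hq.le
        _ = _ := by ring
    refine (Finset.sum_le_sum fun z _ => hpt z).trans ?_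
    rw [Finset.sum_add_distrib, ← Finset.sum_mul, ← Finset.sum_mul, hs, hv.2]
    have : (n : ℝ) * V * (1 / (2 * (n * δ))) = V / (2 * δ) := by field_simp
    rw [← hV, this]
    linarith
end

section
/- Let X, Y, Z be jointly distributed random variables taking values in finite alphabets, and define R_A := I(Z; X,Y), R_B := min{I(X; Y,Z), I(Y; X,Z)}, and R_C := ½(H(X) + H(Y) + H(Z) − H(X,Y,Z)). If R_A < R_C (equivalently, I(Z; X,Y) < I(X; Y)), then R_C < R_B; in particular, I(X;Z) < I(Y; X,Z) and I(Y;Z) < I(X; Y,Z). -/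
open MeasureTheory

/-- The distribution (probability mass function) of a random variable `X` with values in a
finite alphabet `S`, under the probability measure `μ`. -/
noncomputable def distOf {Ω : Type*} [MeasurableSpace Ω] (μ : Measure Ω)
    {S : Type*} (X : Ω → S) (s : S) : ℝ :=
  (μ (X ⁻¹' {s})).toReal

/-- Shannon entropy (base-2 logarithm) of a random variable `X` with values in a finite
alphabet. -/
noncomputable def entH {Ω : Type*} [MeasurableSpace Ω] (μ : Measure Ω)
    {S : Type*} [Fintype S] (X : Ω → S) : ℝ :=
  - ∑ s, distOf μ X s * Real.logb 2 (distOf μ X s)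

/-- Conditional Shannon entropy H(X|Y) (base-2 logarithm). -/
noncomputable def condH {Ω : Type*} [MeasurableSpace Ω] (μ : Measure Ω)
    {S T : Type*} [Fintype S] [Fintype T] (X : Ω → S) (Y : Ω → T) : ℝ :=
  entH μ (fun ω => (X ω, Y ω)) - entH μ Y

/-- Mutual information I(X;Y) (base-2 logarithm). -/
noncomputable def mutInfo {Ω : Type*} [MeasurableSpace Ω] (μ : Measure Ω)
    {S T : Type*} [Fintype S] [Fintype T] (X : Ω → S) (Y : Ω → T) : ℝ :=
  entH μ X + entH μ Y - entH μ (fun ω => (X ω, Y ω))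

theorem distOf_marg {Ω S T : Type*} [MeasurableSpace Ω]
    [Fintype S] [MeasurableSpace S] [MeasurableSingletonClass S]
    [MeasurableSpace T] [MeasurableSingletonClass T]
    (μ : Measure Ω) [IsProbabilityMeasure μ] (A : Ω → S) (B : Ω → T)
    (hA : Measurable A) (hB : Measurable B) (b : T) :
    distOf μ B b = ∑ a, distOf μ (fun ω => (A ω, B ω)) (a, b) := by
  unfold distOf
  have h : B ⁻¹' {b} = ⋃ a ∈ (Finset.univ : Finset S), (fun ω => (A ω, B ω)) ⁻¹' {(a, b)} := by
    ext ω; simp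
  rw [h, measure_biUnion_finset, ENNReal.toReal_sum]
  · intro a _; exact measure_ne_top _ _
  · intro a _ a' _ hne
    refine Set.disjoint_left.2 ?_
    intro ω h1 h2
    simp only [Set.mem_preimage, Set.mem_singleton_iff, Prod.mk.injEq] at h1 h2
    exact hne (h1.1.symm.trans h2.1)
  · intro a _
    exact (hA.prodMk hB) (measurableSet_singleton _)

theorem distOf_equiv {Ω S T : Type*} [MeasurableSpace Ω]
    (μ : Measure Ω) (A : Ω → S) (e : S ≃ T) (s : S) :
    distOf μ (fun ω => e (A ω)) (e s) = distOf μ A s := by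
  unfold distOf
  congr 2
  ext ω; simp

theorem entH_equiv {Ω S T : Type*} [MeasurableSpace Ω] [Fintype S] [Fintype T]
    (μ : Measure Ω) (A : Ω → S) (e : S ≃ T) :
    entH μ (fun ω => e (A ω)) = entH μ A := by
  unfold entH
  rw [← Equiv.sum_comp e]
  simp only [distOf_equiv]

theorem fin_submod {S T U : Type*} [Fintype S] [Fintype T] [Fintype U]
    (p : S → T → U → ℝ) (hp : ∀ x y z, 0 ≤ p x y z)
    (a : S → T → ℝ) (ha : ∀ x y, a x y = ∑ z, p x y z)
    (b : T → U → ℝ) (hb : ∀ y z, b y z = ∑ x, p x y z)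
    (c : T → ℝ) (hc : ∀ y, c y = ∑ x, a x y) (hc' : ∀ y, c y = ∑ z, b y z) :
    (∑ x, ∑ y, a x y * Real.log (a x y)) + ∑ y, ∑ z, b y z * Real.log (b y z) ≤
      (∑ y, c y * Real.log (c y)) + ∑ x, ∑ y, ∑ z, p x y z * Real.log (p x y z) := by
  have ha0 : ∀ x y, 0 ≤ a x y := fun x y => by
    rw [ha]; exact Finset.sum_nonneg fun z _ => hp x y z
  have hb0 : ∀ y z, 0 ≤ b y z := fun y z => by
    rw [hb]; exact Finset.sum_nonneg fun x _ => hp x y z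
  have hc0 : ∀ y, 0 ≤ c y := fun y => by
    rw [hc]; exact Finset.sum_nonneg fun x _ => ha0 x y
  have hpa : ∀ x y z, p x y z ≤ a x y := fun x y z => by
    rw [ha]; exact Finset.single_le_sum (fun z _ => hp x y z) (Finset.mem_univ z)
  have hpb : ∀ x y z, p x y z ≤ b y z := fun x y z => by
    rw [hb]; exact Finset.single_le_sum (f := fun x => p x y z)
      (fun x _ => hp x y z) (Finset.mem_univ x)
  have hac : ∀ x y, a x y ≤ c y := fun x y => by
    rw [hc]; exact Finset.single_le_sum (f := fun x => a x y)
      (fun x _ => ha0 x y) (Finset.mem_univ x)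
  have key : ∀ y x z, p x y z * Real.log (a x y) + p x y z * Real.log (b y z)
      - p x y z * Real.log (c y) - p x y z * Real.log (p x y z) ≤
      a x y * b y z / c y - p x y z := by
    intro y x z
    rcases (hp x y z).eq_or_lt with h | h
    · rw [← h]
      simp only [zero_mul, add_zero, sub_zero]
      exact div_nonneg (mul_nonneg (ha0 _ _) (hb0 _ _)) (hc0 _)
    · have h1 := h.trans_le (hpa x y z)
      have h2 := h.trans_le (hpb x y z)
      have h3 := h1.trans_le (hac x y)
      have := Real.log_le_sub_one_of_pos (x := a x y * b y z / (c y * p x y z)) (by positivity)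
      rw [Real.log_div (by positivity) (by positivity), Real.log_mul h1.ne' h2.ne',
        Real.log_mul h3.ne' h.ne'] at this
      have h4 := mul_le_mul_of_nonneg_left this h.le
      have h5 : p x y z * (a x y * b y z / (c y * p x y z) - 1) =
          a x y * b y z / c y - p x y z := by field_simp
      rw [h5] at h4
      linarith
  have hsum : ∑ y, ∑ x, ∑ z, (a x y * b y z / c y - p x y z) = 0 := by
    refine Finset.sum_eq_zero fun y _ => ?_
    simp only [Finset.sum_sub_distrib]
    have e1 : ∑ x, ∑ z, p x y z = c y := by rw [hc]; simp only [ha]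
    have e2 : ∑ x, ∑ z, a x y * b y z / c y = c y * c y / c y := by
      simp only [← Finset.sum_div, ← Finset.mul_sum, ← hc', ← Finset.sum_mul, ← hc]
    rw [e1, e2, mul_self_div_self, sub_self]
  have hle := Finset.sum_le_sum fun y (_ : y ∈ Finset.univ) =>
    Finset.sum_le_sum fun x (_ : x ∈ Finset.univ) =>
    Finset.sum_le_sum fun z (_ : z ∈ Finset.univ) => key y x z
  rw [hsum] at hle
  simp only [Finset.sum_sub_distrib, Finset.sum_add_distrib] at hle
  have f1 : ∑ y, ∑ x, ∑ z, p x y z * Real.log (a x y) =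
      ∑ x, ∑ y, a x y * Real.log (a x y) := by
    rw [Finset.sum_comm]
    simp only [← Finset.sum_mul, ← ha]
  have f2 : ∑ y, ∑ x, ∑ z, p x y z * Real.log (b y z) =
      ∑ y, ∑ z, b y z * Real.log (b y z) := by
    refine Finset.sum_congr rfl fun y _ => ?_
    rw [Finset.sum_comm]
    simp only [← Finset.sum_mul, ← hb]
  have f3 : ∑ y, ∑ x, ∑ z, p x y z * Real.log (c y) = ∑ y, c y * Real.log (c y) := by
    simp only [← Finset.sum_mul, ← ha, ← hc]
  have f4 : ∑ y, ∑ x, ∑ z, p x y z * Real.log (p x y z) =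
      ∑ x, ∑ y, ∑ z, p x y z * Real.log (p x y z) := Finset.sum_comm
  rw [f1, f2, f3, f4] at hle
  linarith

theorem entH_log {Ω S : Type*} [MeasurableSpace Ω] [Fintype S] (μ : Measure Ω) (A : Ω → S) :
    entH μ A = - (∑ s, distOf μ A s * Real.log (distOf μ A s)) / Real.log 2 := by
  unfold entH Real.logb
  rw [neg_div, Finset.sum_div]
  simp only [mul_div_assoc]

theorem entH_submod {Ω S T U : Type*} [MeasurableSpace Ω]
    [Fintype S] [MeasurableSpace S] [MeasurableSingletonClass S]
    [Fintype T] [MeasurableSpace T] [MeasurableSingletonClass T]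
    [Fintype U] [MeasurableSpace U] [MeasurableSingletonClass U]
    (μ : Measure Ω) [IsProbabilityMeasure μ]
    (X : Ω → S) (Y : Ω → T) (Z : Ω → U)
    (hX : Measurable X) (hY : Measurable Y) (hZ : Measurable Z) :
    entH μ Y + entH μ (fun ω => (X ω, Y ω, Z ω)) ≤
      entH μ (fun ω => (X ω, Y ω)) + entH μ (fun ω => (Y ω, Z ω)) := by
  have h := fin_submod (fun x y z => distOf μ (fun ω => (X ω, Y ω, Z ω)) (x, y, z))
    (fun x y z => ENNReal.toReal_nonneg)
    (fun x y => distOf μ (fun ω => (X ω, Y ω)) (x, y))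
    (fun x y => by
      rw [distOf_marg μ Z (fun ω => (X ω, Y ω)) hZ (hX.prodMk hY)]
      refine Finset.sum_congr rfl fun z _ => ?_
      exact (distOf_equiv μ (fun ω => (Z ω, X ω, Y ω))
        ((Equiv.prodComm U (S × T)).trans (Equiv.prodAssoc S T U)) (z, x, y)).symm)
    (fun y z => distOf μ (fun ω => (Y ω, Z ω)) (y, z))
    (fun y z => distOf_marg μ X _ hX (hY.prodMk hZ) _)
    (fun y => distOf μ Y y)
    (fun y => distOf_marg μ X _ hX hY _)
    (fun y => by
      rw [distOf_marg μ Z Y hZ hY]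
      refine Finset.sum_congr rfl fun z _ => ?_
      exact (distOf_equiv μ (fun ω => (Z ω, Y ω)) (Equiv.prodComm U T) (z, y)).symm)
  simp only [entH_log, Fintype.sum_prod_type, ← add_div]
  have := Real.log_pos one_lt_two
  refine div_le_div_of_nonneg_right ?_ this.le
  linarith

/-- with `R_A := I(Z; X,Y)`, `R_B := min{I(X; Y,Z), I(Y; X,Z)}` and
`R_C := ½(H(X) + H(Y) + H(Z) − H(X,Y,Z))`: if `R_A < R_C`, then `R_C < R_B`; in particular
`I(X;Z) < I(Y; X,Z)` and `I(Y;Z) < I(X; Y,Z)`. -/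
theorem statement15 {Ω 𝒳 𝒴 𝒵 : Type*} [MeasurableSpace Ω]
    [Fintype 𝒳] [MeasurableSpace 𝒳] [MeasurableSingletonClass 𝒳]
    [Fintype 𝒴] [MeasurableSpace 𝒴] [MeasurableSingletonClass 𝒴]
    [Fintype 𝒵] [MeasurableSpace 𝒵] [MeasurableSingletonClass 𝒵]
    (μ : Measure Ω) [IsProbabilityMeasure μ]
    (X : Ω → 𝒳) (Y : Ω → 𝒴) (Z : Ω → 𝒵)
    (hX : Measurable X) (hY : Measurable Y) (hZ : Measurable Z)
    (R_A R_B R_C : ℝ)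
    (hA : R_A = mutInfo μ Z (fun ω => (X ω, Y ω)))
    (hB : R_B = min (mutInfo μ X (fun ω => (Y ω, Z ω))) (mutInfo μ Y (fun ω => (X ω, Z ω))))
    (hC : R_C = (1 / 2) *
      (entH μ X + entH μ Y + entH μ Z - entH μ (fun ω => (X ω, Y ω, Z ω))))
    (hlt : R_A < R_C) :
    R_C < R_B
    ∧ mutInfo μ X Z < mutInfo μ Y (fun ω => (X ω, Z ω))
    ∧ mutInfo μ Y Z < mutInfo μ X (fun ω => (Y ω, Z ω)) := by
  have s1 := entH_submod μ X Y Z hX hY hZ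
  have s2 := entH_submod μ Y X Z hY hX hZ
  have e1 : entH μ (fun ω => (Y ω, X ω, Z ω)) = entH μ (fun ω => (X ω, Y ω, Z ω)) :=
    entH_equiv μ (fun ω => (X ω, Y ω, Z ω))
      (((Equiv.prodAssoc 𝒳 𝒴 𝒵).symm.trans
        ((Equiv.prodComm 𝒳 𝒴).prodCongr (Equiv.refl 𝒵))).trans (Equiv.prodAssoc 𝒴 𝒳 𝒵))
  have e2 : entH μ (fun ω => (Y ω, X ω)) = entH μ (fun ω => (X ω, Y ω)) :=
    entH_equiv μ (fun ω => (X ω, Y ω)) (Equiv.prodComm 𝒳 𝒴)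
  have e3 : entH μ (fun ω => (Z ω, X ω, Y ω)) = entH μ (fun ω => (X ω, Y ω, Z ω)) :=
    entH_equiv μ (fun ω => (X ω, Y ω, Z ω))
      ((Equiv.prodAssoc 𝒳 𝒴 𝒵).symm.trans (Equiv.prodComm (𝒳 × 𝒴) 𝒵))
  subst hA hB hC
  unfold mutInfo at *
  rw [e1, e2] at s2
  rw [e3] at hlt
  rw [e1]
  refine ⟨lt_min ?_ ?_, ?_, ?_⟩ <;> linarith
end
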